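/- Let n ≥ 1 be an integer and let 1 < p < 1 + 2/n. Let K₂ > 0 and let f : [0,∞) → [0,∞) be a locally integrable function with f(u) ≥ K₂ u^p for all u ≥ 0. Let u₀ : ℝⁿ → [0,∞] be measurable and strictly positive on a set of positive Lebesgue measure. Then there is no measurable function u : [0,∞) × ℝⁿ → [0,∞] with u(t,x) < ∞ for almost every (t,x) ∈ (0,∞) × ℝⁿ satisfying, for every t > 0 and every x ∈ ℝⁿ, the integral inequality u(t,x) ≥ ∫_{ℝⁿ} h_t(x−y) u₀(y) dy + ∫₀ᵗ ∫_{ℝⁿ} h_{t−s}(x−y) f(u(s,y)) dy ds. -/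

import Mathlib

open MeasureTheory Real ENNReal

/-- The Gaussian heat kernel `h_t(x) = (4πt)^(-n/2) exp(-‖x‖²/(4t))` on `ℝⁿ`. -/
noncomputable def heatKernel (n : ℕ) (t : ℝ) (x : EuclideanSpace ℝ (Fin n)) : ℝ :=
  (4 * Real.pi * t) ^ (-(n : ℝ) / 2) * Real.exp (-‖x‖ ^ 2 / (4 * t))
lemma measurable_heatKernel (n : ℕ) :
    Measurable fun q : ℝ × EuclideanSpace ℝ (Fin n) => heatKernel n q.1 q.2 := by
  unfold heatKernel
  fun_prop

lemma heatKernel_nonneg (n : ℕ) {t : ℝ} (ht : 0 < t) (x : EuclideanSpace ℝ (Fin n)) :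
    0 ≤ heatKernel n t x := by
  unfold heatKernel
  positivity

/-- The total mass of the heat kernel is `1`. -/
lemma lintegral_heatKernel (n : ℕ) {t : ℝ} (ht : 0 < t) :
    ∫⁻ x, ENNReal.ofReal (heatKernel n t x) = 1 := by
  have h1 : ∫ x, heatKernel n t x = 1 := by
    have h := GaussianFourier.integral_rexp_neg_mul_sq_norm (V := EuclideanSpace ℝ (Fin n))
      (b := 1 / (4 * t)) (by positivity)
    have h2 : ∀ x : EuclideanSpace ℝ (Fin n),
        rexp (-‖x‖ ^ 2 / (4 * t)) = rexp (-(1 / (4 * t)) * ‖x‖ ^ 2) := by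
      intro x; congr 1; ring
    simp only [heatKernel, integral_const_mul, h2]
    rw [h, finrank_euclideanSpace_fin, show Real.pi / (1 / (4 * t)) = 4 * Real.pi * t by
      field_simp, ← Real.rpow_add (by positivity)]
    ring_nf
    simp
  rw [← ofReal_integral_eq_lintegral_ofReal
    (Integrable.of_integral_ne_zero (by rw [h1]; exact one_ne_zero))
    (.of_forall fun x => heatKernel_nonneg n ht x), h1, ENNReal.ofReal_one]

/-- Completing the square in a product of two heat kernels. -/
lemma heatKernel_mul_heatKernel (n : ℕ) {a b : ℝ} (ha : 0 < a) (hb : 0 < b)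
    (v w : EuclideanSpace ℝ (Fin n)) :
    heatKernel n a (v - w) * heatKernel n b w =
      heatKernel n (a + b) v * heatKernel n (a * b / (a + b)) (w - (b / (a + b)) • v) := by
  have hab : 0 < a + b := by positivity
  have key : -‖v - w‖ ^ 2 / (4 * a) + -‖w‖ ^ 2 / (4 * b) =
      -‖v‖ ^ 2 / (4 * (a + b)) + -‖w - (b / (a + b)) • v‖ ^ 2 / (4 * (a * b / (a + b))) := by
    rw [norm_sub_sq_real, norm_sub_sq_real, inner_smul_right, norm_smul, real_inner_comm w v,
      Real.norm_of_nonneg (by positivity)]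
    field_simp
    ring
  unfold heatKernel
  rw [mul_mul_mul_comm, mul_mul_mul_comm (_ ^ _) _ (_ ^ _), ← Real.exp_add, ← Real.exp_add, key,
    ← Real.mul_rpow (by positivity) (by positivity),
    ← Real.mul_rpow (by positivity) (by positivity)]
  congr 2
  field_simp

/-- The semigroup property of the heat kernel. -/
lemma lintegral_heatKernel_mul_heatKernel (n : ℕ) {a b : ℝ} (ha : 0 < a) (hb : 0 < b)
    (x y : EuclideanSpace ℝ (Fin n)) :
    ∫⁻ z, ENNReal.ofReal (heatKernel n a (x - z)) * ENNReal.ofReal (heatKernel n b (z - y)) =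
      ENNReal.ofReal (heatKernel n (a + b) (x - y)) := by
  have hc : 0 < a * b / (a + b) := by positivity
  have hm := measurable_heatKernel n
  have h : ∀ z, ENNReal.ofReal (heatKernel n a (x - z)) * ENNReal.ofReal (heatKernel n b (z - y)) =
      ENNReal.ofReal (heatKernel n (a + b) (x - y)) * ENNReal.ofReal
        (heatKernel n (a * b / (a + b)) (z - (y + (b / (a + b)) • (x - y)))) := by
    intro z
    rw [← ENNReal.ofReal_mul (heatKernel_nonneg n ha _),
      ← ENNReal.ofReal_mul (heatKernel_nonneg n (add_pos ha hb) _), ← sub_sub,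
      ← heatKernel_mul_heatKernel n ha hb, sub_sub_sub_cancel_right]
  simp_rw [h]
  rw [lintegral_const_mul _ (by fun_prop),
    lintegral_sub_right_eq_self (fun z => ENNReal.ofReal (heatKernel n (a * b / (a + b)) z)),
    lintegral_heatKernel n hc, mul_one]

/-- Jensen's inequality for the power function and a density of total mass `1`. -/
lemma rpow_lintegral_mul_le_lintegral_mul_rpow {α : Type*} [MeasurableSpace α] {μ : Measure α}
    {k g : α → ℝ≥0∞} (hk : Measurable k) (hg : Measurable g) (hk1 : ∫⁻ x, k x ∂μ = 1)
    {p : ℝ} (hp : 1 < p) :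
    (∫⁻ x, k x * g x ∂μ) ^ p ≤ ∫⁻ x, k x * g x ^ p ∂μ := by
  have hp0 : 0 < p := by linarith
  have h := ENNReal.lintegral_mul_le_Lp_mul_Lq (μ.withDensity k)
    (Real.HolderConjugate.conjExponent hp) hg.aemeasurable (aemeasurable_const (b := 1))
  have h1 : (μ.withDensity k) Set.univ = 1 := by simp [hk1]
  simp only [Pi.mul_apply, mul_one, ENNReal.one_rpow, lintegral_const, h1] at h
  rw [lintegral_withDensity_eq_lintegral_mul _ hk hg,
    lintegral_withDensity_eq_lintegral_mul _ hk (hg.pow_const p)] at h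
  calc _ ≤ ((∫⁻ x, k x * g x ^ p ∂μ) ^ (1 / p)) ^ p := ENNReal.rpow_le_rpow h hp0.le
    _ = _ := by rw [← ENNReal.rpow_mul, one_div_mul_cancel hp0.ne', ENNReal.rpow_one]

/-- Blow-up for the integral inequality `G(s) ≥ K ∫₀ˢ G(r)^p dr` with `G ≥ A > 0`. -/
lemma lintegral_rpow_eq_top_of_integral_inequality {G : ℝ → ℝ≥0∞} {K A p T : ℝ} (hp : 1 < p)
    (hK : 0 < K) (hA : 0 < A) (hT : 2 * A ^ (1 - p) / K / (1 - 2 ^ (1 - p)) < T)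
    (hGA : ∀ s ∈ Set.Ioo 0 T, ENNReal.ofReal A ≤ G s)
    (hG : ∀ s ∈ Set.Ioo 0 T, ENNReal.ofReal K * ∫⁻ r in Set.Ioc 0 s, G r ^ p ≤ G s) :
    ∫⁻ r in Set.Ioc 0 T, G r ^ p = ⊤ := by
  set D := 2 * A ^ (1 - p) / K with hD
  set q : ℝ := 2 ^ (1 - p) with hq
  have hD0 : 0 < D := by positivity
  have hq0 : 0 < q := by positivity
  have hq1 : q < 1 := Real.rpow_lt_one_of_one_lt_of_neg one_lt_two (by linarith)
  have hp0 : 0 < p := by linarith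
  set τ : ℕ → ℝ := fun k => ∑ i ∈ Finset.range k, D * q ^ i with hτ
  have hτ0 : ∀ k, 0 ≤ τ k := fun k => Finset.sum_nonneg fun i _ => by positivity
  have hτS : ∀ k, τ k ≤ D / (1 - q) := by
    intro k
    simp only [hτ]
    rw [← Finset.mul_sum, div_eq_mul_inv, ← tsum_geometric_of_lt_one hq0.le hq1]
    gcongr
    exact (summable_geometric_of_lt_one hq0.le hq1).sum_le_tsum _ fun i _ => by positivity
  have hS0 : 0 ≤ D / (1 - q) := by simpa [hτ] using hτS 0
  have main : ∀ k, ∀ s ∈ Set.Ioo 0 T, τ k ≤ s → ENNReal.ofReal (2 ^ k * A) ≤ G s := by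
    intro k
    induction k with
    | zero => intro s hs _; simpa using hGA s hs
    | succ k ih =>
      intro s hs hks
      have hstep : τ (k + 1) = τ k + D * q ^ k := Finset.sum_range_succ _ _
      have hB : 0 < 2 ^ k * A := by positivity
      have hid : K * ((D * q ^ k) * (2 ^ k * A) ^ p) = 2 ^ (k + 1) * A := by
        have e1 : q ^ k = (2 ^ k : ℝ) ^ (1 - p) := by
          rw [hq, ← Real.rpow_natCast, ← Real.rpow_mul two_pos.le, ← Real.rpow_natCast,
            ← Real.rpow_mul two_pos.le, mul_comm]
        calc _ = 2 * ((2 ^ k * A) ^ (1 - p) * (2 ^ k * A) ^ p) := by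
              rw [e1, hD, Real.mul_rpow (z := 1 - p) (by positivity) hA.le]
              field_simp
          _ = _ := by
              rw [← Real.rpow_add hB, sub_add_cancel, Real.rpow_one]
              ring
      calc ENNReal.ofReal (2 ^ (k + 1) * A)
          ≤ ENNReal.ofReal (K * ((s - τ k) * (2 ^ k * A) ^ p)) := by
            rw [← hid]
            apply ENNReal.ofReal_le_ofReal
            gcongr
            linarith
        _ = ENNReal.ofReal K * ∫⁻ r in Set.Ioc (τ k) s, ENNReal.ofReal (2 ^ k * A) ^ p := by
            rw [setLIntegral_const, Real.volume_Ioc, ENNReal.ofReal_rpow_of_pos hB,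
              ENNReal.ofReal_mul hK.le, mul_comm (s - τ k), ENNReal.ofReal_mul (by positivity)]
        _ ≤ ENNReal.ofReal K * ∫⁻ r in Set.Ioc (τ k) s, G r ^ p := by
            refine mul_le_mul_right ?_ _
            refine lintegral_mono_ae ((ae_restrict_iff' measurableSet_Ioc).2 (.of_forall ?_))
            intro r hr
            exact ENNReal.rpow_le_rpow
              (ih r ⟨(hτ0 k).trans_lt hr.1, hr.2.trans_lt hs.2⟩ hr.1.le) hp0.le
        _ ≤ ENNReal.ofReal K * ∫⁻ r in Set.Ioc 0 s, G r ^ p := by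
            refine mul_le_mul_right ?_ _
            exact lintegral_mono_set (Set.Ioc_subset_Ioc_left (hτ0 k))
        _ ≤ G s := hG s hs
  have htop : ∀ s ∈ Set.Ioo (D / (1 - q)) T, G s = ⊤ := by
    intro s hs
    refine ENNReal.eq_top_of_forall_nnreal_le fun r => ?_
    obtain ⟨k, hk⟩ := pow_unbounded_of_one_lt ((r : ℝ) / A) one_lt_two
    refine le_trans ?_ (main k s ⟨hS0.trans_lt hs.1, hs.2⟩ ((hτS k).trans hs.1.le))
    rw [← ENNReal.ofReal_coe_nnreal]
    exact ENNReal.ofReal_le_ofReal ((div_lt_iff₀ hA).1 hk).le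
  refine top_unique ?_
  calc (⊤ : ℝ≥0∞) = ∫⁻ r in Set.Ioo (D / (1 - q)) T, ⊤ := by
        rw [setLIntegral_const, Real.volume_Ioo, ENNReal.top_mul]
        simpa using hT
    _ ≤ ∫⁻ r in Set.Ioo (D / (1 - q)) T, G r ^ p := by
        refine lintegral_mono_ae ((ae_restrict_iff' measurableSet_Ioo).2 (.of_forall ?_))
        intro r hr
        rw [htop r hr, ENNReal.top_rpow_of_pos hp0]
    _ ≤ _ := lintegral_mono_set (Set.Ioo_subset_Ioc_self.trans (Set.Ioc_subset_Ioc_left hS0))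

/-- The heat flow of nontrivial nonnegative data decays no faster than `t ^ (-n/2)`, locally
uniformly in space. -/
lemma exists_le_lintegral_heatKernel (n : ℕ) {u₀ : EuclideanSpace ℝ (Fin n) → ℝ≥0∞}
    (hu₀ : Measurable u₀) (hpos : 0 < volume {x | 0 < u₀ x}) :
    ∃ c : ℝ, 0 < c ∧ ∀ t : ℝ, 1 ≤ t → ∀ x ∈ Metric.ball (0 : EuclideanSpace ℝ (Fin n)) 1,
      ENNReal.ofReal (c * t ^ (-(n : ℝ) / 2)) ≤
        ∫⁻ y, ENNReal.ofReal (heatKernel n t (x - y)) * u₀ y := by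
  obtain ⟨m, hm⟩ : ∃ m : ℕ, 0 < ∫⁻ y in Metric.ball 0 (m : ℝ), u₀ y := by
    by_contra! H
    have h0 : ∀ m : ℕ, volume ({x | 0 < u₀ x} ∩ Metric.ball 0 (m : ℝ)) = 0 := by
      intro m
      have h := (lintegral_eq_zero_iff hu₀).1 (le_antisymm (H m) zero_le)
      rw [Filter.EventuallyEq, ae_iff, Measure.restrict_apply' measurableSet_ball] at h
      simpa [pos_iff_ne_zero] using h
    have h1 := measure_iUnion_null h0
    rw [← Set.inter_iUnion, Metric.iUnion_ball_nat, Set.inter_univ] at h1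
    exact hpos.ne' h1
  obtain ⟨d, _, hd⟩ := ENNReal.lt_iff_exists_real_btwn.1 hm
  have hd1 : 0 < d := by simpa using hd.1
  refine ⟨(4 * Real.pi) ^ (-(n : ℝ) / 2) * rexp (-(1 + m) ^ 2 / 4) * d, by positivity, ?_⟩
  intro t ht x hx
  have ht0 : 0 < t := by linarith
  calc _ = ENNReal.ofReal ((4 * Real.pi * t) ^ (-(n : ℝ) / 2) * rexp (-(1 + m) ^ 2 / 4)) *
        ENNReal.ofReal d := by
        rw [← ENNReal.ofReal_mul (by positivity), Real.mul_rpow (y := t) (by positivity) ht0.le]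
        ring_nf
    _ ≤ ENNReal.ofReal ((4 * Real.pi * t) ^ (-(n : ℝ) / 2) * rexp (-(1 + m) ^ 2 / 4)) *
        ∫⁻ y in Metric.ball 0 (m : ℝ), u₀ y := mul_le_mul_right hd.2.le _
    _ = ∫⁻ y in Metric.ball 0 (m : ℝ), ENNReal.ofReal
        ((4 * Real.pi * t) ^ (-(n : ℝ) / 2) * rexp (-(1 + m) ^ 2 / 4)) * u₀ y :=
        (lintegral_const_mul _ hu₀).symm
    _ ≤ ∫⁻ y in Metric.ball 0 (m : ℝ), ENNReal.ofReal (heatKernel n t (x - y)) * u₀ y := by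
        refine lintegral_mono_ae ((ae_restrict_iff' measurableSet_ball).2 (.of_forall ?_))
        intro y hy
        refine mul_le_mul_left (ENNReal.ofReal_le_ofReal ?_) _
        unfold heatKernel
        have hxy : ‖x - y‖ ≤ 1 + m := (norm_sub_le _ _).trans
          (add_le_add (mem_ball_zero_iff.1 hx).le (mem_ball_zero_iff.1 hy).le)
        have hsq : ‖x - y‖ ^ 2 / (4 * t) ≤ (1 + m) ^ 2 / 4 := by
          gcongr
          linarith
        refine mul_le_mul_of_nonneg_left (Real.exp_le_exp.2 ?_) (by positivity)
        rw [neg_div, neg_div]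
        exact neg_le_neg hsq
    _ ≤ _ := setLIntegral_le_lintegral _ _

/-- Applying the heat semigroup to a supersolution of the heat equation with source `w`. -/
lemma heat_integral_le_of_supersolution (n : ℕ) {u₀ : EuclideanSpace ℝ (Fin n) → ℝ≥0∞}
    (hu₀ : Measurable u₀) {u w : ℝ → EuclideanSpace ℝ (Fin n) → ℝ≥0∞}
    (hw : Measurable (Function.uncurry w)) {s T : ℝ} (hs : 0 < s) (hsT : s < T)
    (hu : ∀ x, (∫⁻ y, ENNReal.ofReal (heatKernel n s (x - y)) * u₀ y) +
      (∫⁻ r in Set.Ioc 0 s, ∫⁻ y, ENNReal.ofReal (heatKernel n (s - r) (x - y)) * w r y) ≤ u s x)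
    (x : EuclideanSpace ℝ (Fin n)) :
    (∫⁻ y, ENNReal.ofReal (heatKernel n T (x - y)) * u₀ y) +
      (∫⁻ r in Set.Ioc 0 s, ∫⁻ y, ENNReal.ofReal (heatKernel n (T - r) (x - y)) * w r y) ≤
      ∫⁻ z, ENNReal.ofReal (heatKernel n (T - s) (x - z)) * u s z := by
  have hm := measurable_heatKernel n
  have hTs : 0 < T - s := sub_pos.2 hsT
  have semi : ∀ r < s, ∀ g : EuclideanSpace ℝ (Fin n) → ℝ≥0∞, Measurable g →
      ∫⁻ z, ENNReal.ofReal (heatKernel n (T - s) (x - z)) *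
        ∫⁻ y, ENNReal.ofReal (heatKernel n (s - r) (z - y)) * g y =
      ∫⁻ y, ENNReal.ofReal (heatKernel n (T - r) (x - y)) * g y := by
    intro r hr g hg
    calc _ = ∫⁻ z, ∫⁻ y, ENNReal.ofReal (heatKernel n (T - s) (x - z)) *
          (ENNReal.ofReal (heatKernel n (s - r) (z - y)) * g y) := by
          refine lintegral_congr fun z => (lintegral_const_mul _ (by fun_prop)).symm
      _ = ∫⁻ y, ∫⁻ z, ENNReal.ofReal (heatKernel n (T - s) (x - z)) *
          (ENNReal.ofReal (heatKernel n (s - r) (z - y)) * g y) :=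
          lintegral_lintegral_swap (by fun_prop)
      _ = _ := by
          refine lintegral_congr fun y => ?_
          simp_rw [← mul_assoc]
          rw [lintegral_mul_const _ (by fun_prop),
            lintegral_heatKernel_mul_heatKernel n hTs (sub_pos.2 hr), sub_add_sub_cancel]
  obtain ⟨I, hI⟩ : ∃ I : EuclideanSpace ℝ (Fin n) → ℝ → ℝ≥0∞, ∀ z r,
      I z r = ∫⁻ y, ENNReal.ofReal (heatKernel n (s - r) (z - y)) * w r y := ⟨_, fun _ _ => rfl⟩
  have hIm : Measurable (Function.uncurry I) := by
    simp only [Function.uncurry_def, hI]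
    refine Measurable.lintegral_prod_right
      (f := fun (q : EuclideanSpace ℝ (Fin n) × ℝ) y =>
        ENNReal.ofReal (heatKernel n (s - q.2) (q.1 - y)) * w q.2 y) ?_
    simp only [Function.uncurry_def]
    fun_prop
  simp only [← hI] at hu
  refine le_trans (le_of_eq ?_) (lintegral_mono fun z => mul_le_mul_right (hu z) _)
  simp_rw [mul_add]
  have hleft : Measurable fun z => ∫⁻ y, ENNReal.ofReal (heatKernel n s (z - y)) * u₀ y := by
    refine Measurable.lintegral_prod_right
      (f := fun z y => ENNReal.ofReal (heatKernel n s (z - y)) * u₀ y) ?_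
    simp only [Function.uncurry_def]
    fun_prop
  rw [lintegral_add_left (by fun_prop)]
  congr 1
  · simpa using (semi 0 hs u₀ hu₀).symm
  · symm
    calc ∫⁻ z, ENNReal.ofReal (heatKernel n (T - s) (x - z)) * ∫⁻ r in Set.Ioc 0 s, I z r
        = ∫⁻ z, ∫⁻ r in Set.Ioc 0 s, ENNReal.ofReal (heatKernel n (T - s) (x - z)) * I z r :=
          lintegral_congr fun z => (lintegral_const_mul _ (by fun_prop)).symm
      _ = ∫⁻ r in Set.Ioc 0 s, ∫⁻ z, ENNReal.ofReal (heatKernel n (T - s) (x - z)) * I z r := by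
          refine lintegral_lintegral_swap (Measurable.aemeasurable ?_)
          simp only [Function.uncurry_def]
          fun_prop
      _ = _ := by
          simp only [← restrict_Ioo_eq_restrict_Ioc, hI]
          refine setLIntegral_congr_fun measurableSet_Ioo fun r hr => ?_
          exact semi r hr.2 (w r) (by fun_prop)

theorem no_global_supersolution_subcritical
    (n : ℕ) (hn : 1 ≤ n) (p K₂ : ℝ) (hp : 1 < p) (hpF : p < 1 + 2 / n) (hK₂ : 0 < K₂)
    (f : ℝ → ℝ) (hf0 : ∀ u ≥ (0 : ℝ), 0 ≤ f u)
    (hfloc : LocallyIntegrableOn f (Set.Ici 0) volume)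
    (hfK : ∀ u ≥ (0 : ℝ), K₂ * u ^ p ≤ f u)
    (u₀ : EuclideanSpace ℝ (Fin n) → ℝ≥0∞) (hu₀ : Measurable u₀)
    (hu₀pos : 0 < volume {x | 0 < u₀ x}) :
    ¬ ∃ u : ℝ → EuclideanSpace ℝ (Fin n) → ℝ≥0∞,
      Measurable (Function.uncurry u) ∧
      (∀ᵐ q ∂((volume.restrict (Set.Ioi (0 : ℝ))).prod
          (volume : Measure (EuclideanSpace ℝ (Fin n)))), u q.1 q.2 < ⊤) ∧
      (∀ t : ℝ, 0 < t → ∀ x : EuclideanSpace ℝ (Fin n),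
        (∫⁻ y, ENNReal.ofReal (heatKernel n t (x - y)) * u₀ y)
          + (∫⁻ s in Set.Ioc (0 : ℝ) t,
              ∫⁻ y, ENNReal.ofReal (heatKernel n (t - s) (x - y))
                * ENNReal.ofReal (f ((u s y).toReal)))
          ≤ u t x) := by
  rintro ⟨u, hum, hufin, hu⟩
  have hp0 : 0 < p := by linarith
  have hm := measurable_heatKernel n
  set w : ℝ → EuclideanSpace ℝ (Fin n) → ℝ≥0∞ := fun s y => ENNReal.ofReal K₂ * u s y ^ p with hw
  have hwm : Measurable (Function.uncurry w) := by
    simp only [hw, Function.uncurry_def]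
    fun_prop
  have huw : ∀ t : ℝ, 0 < t → ∀ x : EuclideanSpace ℝ (Fin n),
      (∫⁻ y, ENNReal.ofReal (heatKernel n t (x - y)) * u₀ y) +
        (∫⁻ s in Set.Ioc 0 t, ∫⁻ y, ENNReal.ofReal (heatKernel n (t - s) (x - y)) * w s y) ≤
        u t x := by
    intro t ht x
    refine le_trans (add_le_add_right ?_ _) (hu t ht x)
    have hae := ae_restrict_of_ae_restrict_of_subset
      (Set.Ioc_subset_Ioi_self : Set.Ioc 0 t ⊆ Set.Ioi 0) (Measure.ae_ae_of_ae_prod hufin)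
    refine lintegral_mono_ae ?_
    filter_upwards [hae] with s hs
    refine lintegral_mono_ae ?_
    filter_upwards [hs] with y hy
    refine mul_le_mul_right ?_ _
    refine le_trans (le_of_eq ?_) (ENNReal.ofReal_le_ofReal (hfK _ ENNReal.toReal_nonneg))
    rw [ENNReal.ofReal_mul hK₂.le, ← ENNReal.ofReal_rpow_of_nonneg ENNReal.toReal_nonneg hp0.le,
      ENNReal.ofReal_toReal hy.ne]
  have hjensen : ∀ T r : ℝ, r < T → ∀ x : EuclideanSpace ℝ (Fin n),
      ENNReal.ofReal K₂ * (∫⁻ z, ENNReal.ofReal (heatKernel n (T - r) (x - z)) * u r z) ^ p ≤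
        ∫⁻ y, ENNReal.ofReal (heatKernel n (T - r) (x - y)) * w r y := by
    intro T r hr x
    simp only [hw, mul_left_comm _ (ENNReal.ofReal K₂)]
    rw [lintegral_const_mul _ (by fun_prop)]
    refine mul_le_mul_right
      (rpow_lintegral_mul_le_lintegral_mul_rpow (by fun_prop) (by fun_prop) ?_ hp) _
    rw [lintegral_sub_left_eq_self (fun z => ENNReal.ofReal (heatKernel n (T - r) z)) x,
      lintegral_heatKernel n (sub_pos.2 hr)]
  obtain ⟨c, hc, hlow⟩ := exists_le_lintegral_heatKernel n hu₀ hu₀pos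
  have hn0 : (0 : ℝ) < n := by exact_mod_cast hn
  set θ : ℝ := (-(n : ℝ) / 2) * (1 - p) with hθ
  have hθ1 : θ < 1 := by
    have : (p - 1) * n < 2 := (lt_div_iff₀ hn0).1 (by linarith)
    rw [hθ]
    linarith
  obtain ⟨T₀, hT₀⟩ := Filter.eventually_atTop.1
    ((tendsto_rpow_atTop (sub_pos.2 hθ1)).eventually_gt_atTop
      (2 * c ^ (1 - p) / K₂ / (1 - 2 ^ (1 - p))))
  have htop : ∀ T : ℝ, max 1 T₀ ≤ T → ∀ x ∈ Metric.ball (0 : EuclideanSpace ℝ (Fin n)) 1,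
      u T x = ⊤ := by
    intro T hT x hx
    have hT1 : 1 ≤ T := (le_max_left _ _).trans hT
    have hT0 : 0 < T := by linarith
    set G : ℝ → ℝ≥0∞ := fun s => ∫⁻ z, ENNReal.ofReal (heatKernel n (T - s) (x - z)) * u s z
      with hG
    have hGm : Measurable G := by
      refine Measurable.lintegral_prod_right
        (f := fun s z => ENNReal.ofReal (heatKernel n (T - s) (x - z)) * u s z) ?_
      simp only [Function.uncurry_def]
      fun_prop
    have hsrc : ∀ s ≤ T, ENNReal.ofReal K₂ * ∫⁻ r in Set.Ioc 0 s, G r ^ p ≤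
        ∫⁻ r in Set.Ioc 0 s, ∫⁻ y, ENNReal.ofReal (heatKernel n (T - r) (x - y)) * w r y := by
      intro s hs
      rw [← lintegral_const_mul _ (by fun_prop), ← restrict_Ioo_eq_restrict_Ioc]
      refine lintegral_mono_ae ((ae_restrict_iff' measurableSet_Ioo).2 (.of_forall ?_))
      exact fun r hr => hjensen T r (hr.2.trans_le hs) x
    have hGs : ∀ s ∈ Set.Ioo 0 T, _ := fun s hs =>
      heat_integral_le_of_supersolution n hu₀ hwm hs.1 hs.2 (huw s hs.1) x
    have hblow : ∫⁻ r in Set.Ioc 0 T, G r ^ p = ⊤ := by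
      refine lintegral_rpow_eq_top_of_integral_inequality hp hK₂
        (A := c * T ^ (-(n : ℝ) / 2)) (by positivity) ?_
        (fun s hs => (hlow T hT1 x hx).trans (le_self_add.trans (hGs s hs)))
        (fun s hs => (hsrc s hs.2.le).trans (le_add_self.trans (hGs s hs)))
      have h := hT₀ T ((le_max_right _ _).trans hT)
      rw [Real.mul_rpow hc.le (by positivity), ← Real.rpow_mul hT0.le, ← hθ]
      calc _ = 2 * c ^ (1 - p) / K₂ / (1 - 2 ^ (1 - p)) * T ^ θ := by ring
        _ < T ^ (1 - θ) * T ^ θ := by gcongr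
        _ = T := by rw [← Real.rpow_add hT0, sub_add_cancel, Real.rpow_one]
    refine top_unique (le_trans ?_ (le_add_self.trans (huw T hT0 x)))
    refine le_trans ?_ (hsrc T le_rfl)
    rw [hblow, ENNReal.mul_top (by simpa using hK₂)]
  have hT0 : 0 < max 1 T₀ := zero_lt_one.trans_le (le_max_left _ _)
  have hnull : ((volume.restrict (Set.Ioi (0 : ℝ))).prod
      (volume : Measure (EuclideanSpace ℝ (Fin n))))
      (Set.Ioi (max 1 T₀) ×ˢ Metric.ball 0 1) = 0 := by
    refine measure_mono_null ?_ (ae_iff.1 hufin)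
    rintro ⟨t, x⟩ ⟨ht, hx⟩
    simpa using htop t (le_of_lt ht) x hx
  rw [Measure.prod_prod, Measure.restrict_apply measurableSet_Ioi,
    Set.inter_eq_left.2 (Set.Ioi_subset_Ioi hT0.le), Real.volume_Ioi, mul_eq_zero] at hnull
  rcases hnull with h | h
  · exact ENNReal.top_ne_zero h
  · exact (Metric.measure_ball_pos volume _ one_pos).ne' h
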